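/- Suppose λ = (λ_{IJ}) satisfies C₀ := sup_{I₀,J₀∈D} ((|I₀||J₀|)^{-1} Σ_{J∈D, J⊆J₀} λ_{I₀J}²)^{1/2} < ∞. Then there is an absolute constant C > 0 such that for all families (g_J)_{J∈D}, (u_I)_{I∈D} of L²(ℝ) functions with only finitely many nonzero members, Σ_{I,J} |λ_{IJ} ⟨g_J⟩_I ⟨u_I⟩_J| ≤ C C₀ (Σ_J ‖g_J‖₂²)^{1/2} (Σ_I ‖u_I‖₂). That is, the bilinear form Γ_λ is unconditionally bounded from ℓ²(L²) × ℓ¹(L²) to ℝ. -/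

import Mathlib

open MeasureTheory
open scoped ENNReal

noncomputable section

/-- A sequence `λ = (λ_{IJ})` indexed by pairs of dyadic intervals; a dyadic interval
`[2^{-i}k, 2^{-i}(k+1))` is encoded by the pair `(i, k) : ℤ × ℤ`. -/
abbrev ParaSeq := (ℤ × ℤ) → (ℤ × ℤ) → ℝ

/-- The dyadic interval `[2^{-i} k, 2^{-i}(k+1))` encoded by the pair `p = (i, k) : ℤ × ℤ`. -/
def dyadic (p : ℤ × ℤ) : Set ℝ := Set.Ico ((2:ℝ) ^ (-p.1) * p.2) ((2:ℝ) ^ (-p.1) * (p.2 + 1))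

/-- The length `|I| = 2^{-i}` of the dyadic interval encoded by `p = (i, k)`. -/
def dlen (p : ℤ × ℤ) : ℝ := (2:ℝ) ^ (-p.1)

/-- The average `⟨f⟩_I = |I|⁻¹ ∫_I f`. -/
def avg (f : ℝ → ℝ) (p : ℤ × ℤ) : ℝ := (dlen p)⁻¹ * ∫ x in dyadic p, f x

/-- Admissible families `(u_I)_{I ∈ D}` of `L²(ℝ)` functions: only finitely many nonzero
members and `Σ_I ‖u_I‖₂² = 1`. -/
def Adm : Set ((ℤ × ℤ) → ℝ → ℝ) :=
  {u | (∀ p, MemLp (u p) 2 volume) ∧ {p | u p ≠ 0}.Finite ∧ (∑' p : ℤ × ℤ, ∫ x, (u p x) ^ 2) = 1}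

/-- The bilinear sum `Σ_{I,J} λ_{IJ} ⟨g_J⟩_I ⟨u_I⟩_J`. -/
def pairSum (lam : ParaSeq) (u g : (ℤ × ℤ) → ℝ → ℝ) : ℝ :=
  ∑' pq : (ℤ × ℤ) × (ℤ × ℤ), lam pq.1 pq.2 * avg (g pq.2) pq.1 * avg (u pq.1) pq.2

/-- The norm `‖λ‖_X`, as an element of `[0, ∞]`. -/
def Xnorm (lam : ParaSeq) : ℝ≥0∞ :=
  ⨆ (u : Adm) (g : Adm), ENNReal.ofReal |pairSum lam u.1 g.1|

/-- The norm `‖λ‖_{X'}`, as an element of `[0, ∞]`. -/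
def Xprime (lam : ParaSeq) : ℝ≥0∞ :=
  ⨆ (u : Adm) (g : Adm),
    ENNReal.ofReal
      (∑' pq : (ℤ × ℤ) × (ℤ × ℤ), |lam pq.1 pq.2 * avg (g.1 pq.2) pq.1 * avg (u.1 pq.1) pq.2|)

/-- The combinatorial form of the inclusion of the dyadic interval `q` in `p`. -/
def Below (p q : ℤ × ℤ) : Prop :=
  p.1 ≤ q.1 ∧ q.2 / 2 ^ (q.1 - p.1).toNat = p.2

instance (p q : ℤ × ℤ) : Decidable (Below p q) := inferInstanceAs (Decidable (_ ∧ _))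

lemma dlen_pos (p : ℤ × ℤ) : 0 < dlen p := zpow_pos two_pos _

lemma dlen_child (i k l : ℤ) : dlen (i + 1, l) = dlen (i, k) / 2 := by
  simp only [dlen]
  rw [neg_add, zpow_add₀ two_ne_zero]
  norm_num [div_eq_mul_inv]

lemma volume_real_dyadic (p : ℤ × ℤ) : volume.real (dyadic p) = dlen p := by
  have h := dlen_pos p
  unfold dyadic
  rw [Real.volume_real_Ico_of_le]
  · unfold dlen; ring
  · exact mul_le_mul_of_nonneg_left (by linarith) h.le

lemma measurableSet_dyadic (p : ℤ × ℤ) : MeasurableSet (dyadic p) := measurableSet_Ico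

instance (p : ℤ × ℤ) : IsFiniteMeasure (volume.restrict (dyadic p)) :=
  ⟨by simp [dyadic]⟩

lemma dyadic_subset_of_below {p q : ℤ × ℤ} (h : Below p q) : dyadic q ⊆ dyadic p := by
  obtain ⟨i, k⟩ := p
  obtain ⟨j, l⟩ := q
  obtain ⟨h₁, h₂⟩ := h
  obtain ⟨n, rfl⟩ := Int.le.dest h₁
  simp only [add_sub_cancel_left, Int.toNat_natCast] at h₂
  have hn : (0 : ℤ) < 2 ^ n := by positivity
  have hl : 2 ^ n * k ≤ l := by rw [← h₂]; exact Int.mul_ediv_self_le hn.ne'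
  have hr : l + 1 ≤ 2 ^ n * (k + 1) := by
    rw [← h₂, mul_add, mul_one]; exact Int.lt_mul_ediv_self_add hn
  have hl' : (2 : ℝ) ^ n * k ≤ l := by exact_mod_cast hl
  have hr' : (l : ℝ) + 1 ≤ 2 ^ n * (k + 1) := by exact_mod_cast hr
  have hs : (2 : ℝ) ^ (-i) = 2 ^ (-(i + (n : ℤ))) * 2 ^ n := by
    rw [← zpow_natCast, ← zpow_add₀ two_ne_zero]; congr 1; ring
  have hp : (0 : ℝ) < 2 ^ (-(i + (n : ℤ))) := by positivity
  unfold dyadic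
  apply Set.Ico_subset_Ico
  · simp only [hs, mul_assoc]; gcongr
  · simp only [hs, mul_assoc]; gcongr

lemma below_iff_of_lt {i k : ℤ} {q : ℤ × ℤ} (h : i < q.1) :
    Below (i, k) q ↔ Below (i + 1, 2 * k) q ∨ Below (i + 1, 2 * k + 1) q := by
  obtain ⟨j, l⟩ := q
  obtain ⟨n, rfl⟩ := Int.le.dest (Int.add_one_le_of_lt h)
  have h₁ : (i + 1 + (n : ℤ) - i).toNat = n + 1 := by omega
  have h₂ : (i + 1 + (n : ℤ) - (i + 1)).toNat = n := by omega
  simp only [Below, h₁, h₂, pow_succ]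
  rw [← Int.ediv_ediv_of_nonneg (by positivity)]
  omega

lemma below_iff_of_eq {p q : ℤ × ℤ} (h : p.1 = q.1) : Below p q ↔ p = q := by
  simp [Below, h, Prod.ext_iff, eq_comm]

lemma sum_below (S : Finset (ℤ × ℤ)) (b : ℤ × ℤ → ℝ) (i k : ℤ) :
    ∑ q ∈ S with Below (i, k) q, b q = (if (i, k) ∈ S then b (i, k) else 0) +
      (∑ q ∈ S with Below (i + 1, 2 * k) q, b q) +
      ∑ q ∈ S with Below (i + 1, 2 * k + 1) q, b q := by
  simp only [Finset.sum_filter]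
  rw [← Finset.sum_ite_eq S (i, k) b, ← Finset.sum_add_distrib, ← Finset.sum_add_distrib]
  refine Finset.sum_congr rfl fun q _ => ?_
  rcases lt_trichotomy i q.1 with h | h | h
  · have h₁ : ¬ (i, k) = q := by rintro rfl; exact lt_irrefl _ h
    simp only [below_iff_of_lt h, if_neg h₁]
    by_cases h₂ : Below (i + 1, 2 * k) q
    · have h₃ : ¬ Below (i + 1, 2 * k + 1) q := by
        intro h₃
        have := h₂.2.symm.trans h₃.2
        simp at this
      simp [h₂, h₃]
    · simp [h₂]
  · have h₂ (l : ℤ) : ¬ Below (i + 1, l) q := fun h' => by have := h'.1; simp at this; omega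
    simp [h₂, below_iff_of_eq (p := (i, k)) h]
  · have h₁ : ¬ (i, k) = q := by rintro rfl; exact lt_irrefl _ h
    have h₂ (l : ℤ) : ¬ Below (i + 1, l) q := fun h' => by have := h'.1; simp at this; omega
    have h₃ : ¬ Below (i, k) q := fun h' => absurd h'.1 (not_le.2 h)
    simp [h₁, h₂, h₃]

lemma setIntegral_dyadic {f : ℝ → ℝ} (i k : ℤ) (hf : IntegrableOn f (dyadic (i, k))) :
    ∫ x in dyadic (i, k), f x = (∫ x in dyadic (i + 1, 2 * k), f x) +
      ∫ x in dyadic (i + 1, 2 * k + 1), f x := by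
  have hs : (2 : ℝ) ^ (-i) = 2 ^ (-(i + 1)) * 2 := by
    rw [← zpow_add_one₀ two_ne_zero]; congr 1; ring
  have hp : (0 : ℝ) < 2 ^ (-(i + 1)) := by positivity
  have hu : dyadic (i, k) = dyadic (i + 1, 2 * k) ∪ dyadic (i + 1, 2 * k + 1) := by
    simp only [dyadic, hs]
    push_cast
    rw [Set.Ico_union_Ico_eq_Ico]
    · congr 1 <;> ring
    · gcongr; linarith
    · gcongr; linarith
  have hd : Disjoint (dyadic (i + 1, 2 * k)) (dyadic (i + 1, 2 * k + 1)) := by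
    simp only [dyadic]
    push_cast
    exact Set.Ico_disjoint_Ico_same
  rw [hu] at hf ⊢
  exact setIntegral_union hd (measurableSet_dyadic _) (hf.mono_set Set.subset_union_left)
    (hf.mono_set Set.subset_union_right)

lemma sq_setIntegral_le {f : ℝ → ℝ} (hf : MemLp f 2 volume) (p : ℤ × ℤ) :
    (∫ x in dyadic p, f x) ^ 2 ≤ dlen p * ∫ x in dyadic p, f x ^ 2 := by
  have h₁ : Integrable f (volume.restrict (dyadic p)) := hf.restrict _ |>.integrable one_le_two
  have h₂ : Integrable (fun x => f x ^ 2) (volume.restrict (dyadic p)) :=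
    (hf.restrict _).integrable_sq
  have hL := dlen_pos p
  set c := (dlen p)⁻¹ * ∫ x in dyadic p, f x with hc
  have h : 0 ≤ ∫ x in dyadic p, (f x - c) ^ 2 := integral_nonneg fun x => sq_nonneg _
  have he : ∫ x in dyadic p, (f x - c) ^ 2 =
      (∫ x in dyadic p, f x ^ 2) - 2 * c * (∫ x in dyadic p, f x) + c ^ 2 * dlen p := by
    rw [← integral_const_mul, ← integral_sub h₂ (h₁.const_mul _)]
    have hk : c ^ 2 * dlen p = ∫ x in dyadic p, c ^ 2 := by
      rw [setIntegral_const, volume_real_dyadic, smul_eq_mul, mul_comm]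
    have h₃ : Integrable (fun x => f x ^ 2 - 2 * c * f x) (volume.restrict (dyadic p)) :=
      h₂.sub (h₁.const_mul _)
    rw [hk, ← integral_add h₃ (integrable_const _)]
    congr 1; ext x; ring
  have hI : ∫ x in dyadic p, f x = dlen p * c := by rw [hc]; field_simp
  rw [he, hI] at h
  rw [hI]
  nlinarith

lemma bellman_step {A L X Y α x y : ℝ} (hL : 0 < L) (hX : 0 < X) (hY : 0 < Y) (hα : 0 ≤ α)
    (h : X + Y + α ≤ 2 * A * L) :
    α * (L⁻¹ * (x + y)) ^ 2 + 4 * A ^ 2 * ((x + y) ^ 2 / (X + Y + α)) ≤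
      4 * A ^ 2 * (x ^ 2 / X + y ^ 2 / Y) := by
  have h₁ : (x + y) ^ 2 / (X + Y) ≤ x ^ 2 / X + y ^ 2 / Y := by
    rw [div_add_div _ _ hX.ne' hY.ne', div_le_div_iff₀ (by positivity) (by positivity)]
    nlinarith [sq_nonneg (x * Y - y * X)]
  have h₂ : α * (L⁻¹ * (x + y)) ^ 2 ≤
      4 * A ^ 2 * ((x + y) ^ 2 * (α / ((X + Y) * (X + Y + α)))) := by
    have h₃ : (L⁻¹) ^ 2 ≤ 4 * A ^ 2 / ((X + Y) * (X + Y + α)) := by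
      rw [inv_pow, ← one_div, div_le_div_iff₀ (by positivity) (by positivity)]
      nlinarith
    calc α * (L⁻¹ * (x + y)) ^ 2 = (L⁻¹) ^ 2 * (α * (x + y) ^ 2) := by ring
      _ ≤ 4 * A ^ 2 / ((X + Y) * (X + Y + α)) * (α * (x + y) ^ 2) := by gcongr
      _ = _ := by ring
  have h₄ : (x + y) ^ 2 * (α / ((X + Y) * (X + Y + α))) + (x + y) ^ 2 / (X + Y + α) =
      (x + y) ^ 2 / (X + Y) := by
    field_simp
    ring
  nlinarith [mul_le_mul_of_nonneg_left h₁ (by positivity : 0 ≤ 4 * A ^ 2)]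

/-- The local form of the dyadic Carleson embedding theorem, with the Bellman function
`4 A (F - f² / (1 + M / A))`. -/
lemma carleson_embedding_local {S : Finset (ℤ × ℤ)} {a : ℤ × ℤ → ℝ} {A : ℝ} (hA : 0 < A)
    (ha : ∀ q, 0 ≤ a q) (hS : ∀ p, ∑ q ∈ S with Below p q, a q ≤ A * dlen p)
    {f : ℝ → ℝ} (hf : MemLp f 2 volume) (n : ℕ) (i k : ℤ) (hn : ∀ q ∈ S, q.1 < i + n) :
    ∑ q ∈ S with Below (i, k) q, a q * avg f q ^ 2 ≤
      4 * A * (∫ x in dyadic (i, k), f x ^ 2) - 4 * A ^ 2 * ((∫ x in dyadic (i, k), f x) ^ 2 /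
        (A * dlen (i, k) + ∑ q ∈ S with Below (i, k) q, a q)) := by
  induction n generalizing i k with
  | zero =>
    have hL := dlen_pos (i, k)
    have he : S.filter (Below (i, k)) = ∅ := by
      refine Finset.filter_eq_empty_iff.2 fun q hq h => ?_
      have := hn q hq
      have := h.1
      simp at *
      omega
    simp only [he, Finset.sum_empty, add_zero]
    have h := sq_setIntegral_le hf (i, k)
    rw [sub_nonneg]
    calc 4 * A ^ 2 * ((∫ x in dyadic (i, k), f x) ^ 2 / (A * dlen (i, k)))
        ≤ 4 * A ^ 2 * ((dlen (i, k) * ∫ x in dyadic (i, k), f x ^ 2) / (A * dlen (i, k))) := by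
          gcongr
      _ = _ := by field_simp
  | succ n ih =>
    have hn' : ∀ q ∈ S, q.1 < i + 1 + n := fun q hq => by
      have := hn q hq
      push_cast at this
      omega
    have h₁ := ih (i + 1) (2 * k) hn'
    have h₂ := ih (i + 1) (2 * k + 1) hn'
    have hL := dlen_pos (i, k)
    have hM := hS (i, k)
    have hm (p) : 0 ≤ ∑ q ∈ S with Below p q, a q := Finset.sum_nonneg fun q _ => ha q
    have hm₁ := hm (i + 1, 2 * k)
    have hm₂ := hm (i + 1, 2 * k + 1)
    rw [dlen_child i k] at h₁ h₂
    rw [sum_below] at hM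
    rw [sum_below, sum_below S a, setIntegral_dyadic i k (hf.restrict _).integrable_sq]
    have hI := setIntegral_dyadic i k (f := f) ((hf.restrict _).integrable one_le_two)
    set x := ∫ x in dyadic (i + 1, 2 * k), f x
    set y := ∫ x in dyadic (i + 1, 2 * k + 1), f x
    set m₁ := ∑ q ∈ S with Below (i + 1, 2 * k) q, a q
    set m₂ := ∑ q ∈ S with Below (i + 1, 2 * k + 1) q, a q
    set α := if (i, k) ∈ S then a (i, k) else 0 with hα
    have hα₀ : 0 ≤ α := by rw [hα]; split_ifs <;> simp [ha]
    have hα' : (if (i, k) ∈ S then a (i, k) * avg f (i, k) ^ 2 else 0) =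
        α * ((dlen (i, k))⁻¹ * (x + y)) ^ 2 := by
      rw [hα, ← hI]; simp [avg]
    have key := bellman_step (A := A) (L := dlen (i, k)) (X := A * (dlen (i, k) / 2) + m₁)
      (Y := A * (dlen (i, k) / 2) + m₂) (α := α) (x := x) (y := y) hL (by positivity)
      (by positivity) hα₀ (by linarith)
    have hD : A * dlen (i, k) + (α + m₁ + m₂) =
        A * (dlen (i, k) / 2) + m₁ + (A * (dlen (i, k) / 2) + m₂) + α := by ring
    rw [hα', hI, hD]
    linarith

lemma sum_setIntegral_dyadic_le {f : ℝ → ℝ} (hf : Integrable f) (h₀ : 0 ≤ f) (i : ℤ)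
    (K : Finset ℤ) : ∑ k ∈ K, ∫ x in dyadic (i, k), f x ≤ ∫ x, f x := by
  have hp : (0 : ℝ) < 2 ^ (-i) := by positivity
  rw [← integral_biUnion_finset K (fun k _ => measurableSet_dyadic _) _
    (fun k _ => hf.integrableOn)]
  · exact setIntegral_le_integral hf (Filter.Eventually.of_forall h₀)
  · intro k _ l _ hkl
    refine Set.disjoint_left.2 fun x hx hy => hkl ?_
    simp only [dyadic, Set.mem_Ico] at hx hy
    have h₁ := lt_of_mul_lt_mul_left (hx.1.trans_lt hy.2) hp.le
    have h₂ := lt_of_mul_lt_mul_left (hy.1.trans_lt hx.2) hp.le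
    norm_cast at h₁ h₂
    omega

/-- The dyadic Carleson embedding theorem, for finitely supported sequences. -/
theorem carleson_embedding {S : Finset (ℤ × ℤ)} {a : ℤ × ℤ → ℝ} {A : ℝ} (hA : 0 < A)
    (ha : ∀ q, 0 ≤ a q) (hS : ∀ p, ∑ q ∈ S with Below p q, a q ≤ A * dlen p)
    {f : ℝ → ℝ} (hf : MemLp f 2 volume) :
    ∑ q ∈ S, a q * avg f q ^ 2 ≤ 4 * A * ∫ x, f x ^ 2 := by
  obtain ⟨i, hi⟩ := (S.image Prod.fst).bddBelow
  obtain ⟨j, hj⟩ := (S.image Prod.fst).bddAbove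
  have hi' : ∀ q ∈ S, i ≤ q.1 := fun q hq =>
    hi (Finset.mem_coe.2 (Finset.mem_image_of_mem _ hq))
  have hj' : ∀ q ∈ S, q.1 < i + ((j + 1 - i).toNat : ℤ) := fun q hq => by
    have := hj (Finset.mem_coe.2 (Finset.mem_image_of_mem _ hq))
    omega
  let top : ℤ × ℤ → ℤ := fun q => q.2 / 2 ^ (q.1 - i).toNat
  rw [← Finset.sum_fiberwise_of_maps_to (t := S.image top) (g := top)
    fun q hq => Finset.mem_image_of_mem _ hq]
  refine le_trans (Finset.sum_le_sum fun k _ => ?_) (le_trans (Finset.mul_sum _ _ _).ge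
    (mul_le_mul_of_nonneg_left (sum_setIntegral_dyadic_le hf.integrable_sq
      (fun x => sq_nonneg _) i (S.image top)) (by positivity : 0 ≤ 4 * A)))
  have he : S.filter (fun q => top q = k) = S.filter (Below (i, k)) :=
    Finset.filter_congr fun q hq => ⟨fun h => ⟨hi' q hq, h⟩, fun h => h.2⟩
  rw [he]
  refine (carleson_embedding_local hA ha hS hf _ i k hj').trans (sub_le_self _ ?_)
  have hL := dlen_pos (i, k)
  have : 0 ≤ ∑ q ∈ S with Below (i, k) q, a q := Finset.sum_nonneg fun q _ => ha q
  positivity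

lemma avg_sq_le {f : ℝ → ℝ} (hf : MemLp f 2 volume) (p : ℤ × ℤ) :
    avg f p ^ 2 ≤ (dlen p)⁻¹ * ∫ x, f x ^ 2 := by
  have hL := dlen_pos p
  have h : ∫ x in dyadic p, f x ^ 2 ≤ ∫ x, f x ^ 2 :=
    setIntegral_le_integral hf.integrable_sq (Filter.Eventually.of_forall fun x => sq_nonneg _)
  calc avg f p ^ 2 = (dlen p)⁻¹ ^ 2 * (∫ x in dyadic p, f x) ^ 2 := by rw [avg, mul_pow]
    _ ≤ (dlen p)⁻¹ ^ 2 * (dlen p * ∫ x, f x ^ 2) := by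
      gcongr
      exact (sq_setIntegral_le hf p).trans (by gcongr)
    _ = _ := by field_simp

lemma sum_below_le_of_tsum_le {c : ℤ × ℤ → ℝ} {B : ℝ} {p : ℤ × ℤ} (hB : 0 ≤ B)
    (hc : ∀ q, 0 ≤ c q)
    (h : ∑' q : {q // dyadic q ⊆ dyadic p}, ENNReal.ofReal (c q.1) ≤ ENNReal.ofReal B)
    (S : Finset (ℤ × ℤ)) : ∑ q ∈ S with Below p q, c q ≤ B := by
  classical
  rw [← ENNReal.ofReal_le_ofReal_iff hB, ENNReal.ofReal_sum_of_nonneg fun q _ => hc q]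
  refine le_trans ?_ h
  have hmem : ∀ q ∈ S.filter (Below p), dyadic q ⊆ dyadic p := fun q hq =>
    dyadic_subset_of_below (Finset.mem_filter.1 hq).2
  rw [← Finset.sum_subtype_of_mem (p := fun q => dyadic q ⊆ dyadic p)
    (fun q => ENNReal.ofReal (c q)) hmem]
  exact ENNReal.sum_le_tsum _

lemma sum_abs_mul_avg_le {c : ℤ × ℤ → ℝ} {C₀ : ℝ} (hC : 0 < C₀) {p : ℤ × ℤ}
    (G : Finset (ℤ × ℤ))
    (h : ∀ r, ∑ q ∈ G with Below r q, c q ^ 2 ≤ C₀ ^ 2 * (dlen p * dlen r))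
    {u : ℝ → ℝ} (hu : MemLp u 2 volume) {g : ℤ × ℤ → ℝ → ℝ} (hg : ∀ q, MemLp (g q) 2 volume) :
    ∑ q ∈ G, |c q * avg (g q) p * avg u q| ≤
      2 * C₀ * √(∑ q ∈ G, ∫ x, g q x ^ 2) * √(∫ x, u x ^ 2) := by
  have hL := dlen_pos p
  have hU : 0 ≤ ∫ x, u x ^ 2 := integral_nonneg fun x => sq_nonneg _
  have h₁ : ∑ q ∈ G, |c q * avg u q| ^ 2 ≤ 4 * (C₀ ^ 2 * dlen p) * ∫ x, u x ^ 2 := by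
    have := carleson_embedding (S := G) (a := fun q => c q ^ 2) (A := C₀ ^ 2 * dlen p)
      (by positivity) (fun q => sq_nonneg _) (fun r => by rw [mul_assoc]; exact h r) hu
    simpa only [sq_abs, mul_pow] using this
  have h₂ : ∑ q ∈ G, |avg (g q) p| ^ 2 ≤ (dlen p)⁻¹ * ∑ q ∈ G, ∫ x, g q x ^ 2 := by
    rw [Finset.mul_sum]
    exact Finset.sum_le_sum fun q _ => by rw [sq_abs]; exact avg_sq_le (hg q) p
  calc ∑ q ∈ G, |c q * avg (g q) p * avg u q|
      = ∑ q ∈ G, |c q * avg u q| * |avg (g q) p| :=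
        Finset.sum_congr rfl fun q _ => by rw [← abs_mul]; congr 1; ring
    _ ≤ √(∑ q ∈ G, |c q * avg u q| ^ 2) * √(∑ q ∈ G, |avg (g q) p| ^ 2) :=
        Real.sum_mul_le_sqrt_mul_sqrt _ _ _
    _ ≤ √(4 * (C₀ ^ 2 * dlen p) * ∫ x, u x ^ 2) * √((dlen p)⁻¹ * ∑ q ∈ G, ∫ x, g q x ^ 2) := by
        gcongr
    _ = √((2 * C₀) ^ 2 * ((∑ q ∈ G, ∫ x, g q x ^ 2) * ∫ x, u x ^ 2)) := by
        rw [← Real.sqrt_mul (by positivity)]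
        congr 1
        field_simp
        ring
    _ = _ := by
        rw [Real.sqrt_mul (by positivity), Real.sqrt_sq (by positivity), Real.sqrt_mul' _ hU,
          ← mul_assoc]

/-- there is an absolute constant `C > 0` such that whenever
`Σ_{J ⊆ J₀} λ_{I₀J}² ≤ C₀² |I₀||J₀|` for all `I₀, J₀`, the form `Γ_λ` is unconditionally
bounded `ℓ²(L²) × ℓ¹(L²) → ℝ`:
`Σ_{I,J} |λ_{IJ} ⟨g_J⟩_I ⟨u_I⟩_J| ≤ C C₀ (Σ_J ‖g_J‖₂²)^{1/2} (Σ_I ‖u_I‖₂)`. -/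
theorem unconditional_l2_l1_bound :
    ∃ C : ℝ, 0 < C ∧ ∀ (lam : ParaSeq) (C₀ : ℝ), 0 ≤ C₀ →
      (∀ p q : ℤ × ℤ,
        (∑' q' : {q' : ℤ × ℤ // dyadic q' ⊆ dyadic q}, ENNReal.ofReal ((lam p q'.1) ^ 2)) ≤
          ENNReal.ofReal (C₀ ^ 2 * (dlen p * dlen q))) →
      ∀ u g : (ℤ × ℤ) → ℝ → ℝ,
        (∀ p, MemLp (u p) 2 volume) → (∀ q, MemLp (g q) 2 volume) →
        {p | u p ≠ 0}.Finite → {q | g q ≠ 0}.Finite →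
        (∑' pq : (ℤ × ℤ) × (ℤ × ℤ),
            |lam pq.1 pq.2 * avg (g pq.2) pq.1 * avg (u pq.1) pq.2|) ≤
          C * C₀ * Real.sqrt (∑' q : ℤ × ℤ, ∫ x, (g q x) ^ 2) *
            ∑' p : ℤ × ℤ, Real.sqrt (∫ x, (u p x) ^ 2) := by
  refine ⟨2, two_pos, fun lam C₀ hC h u g hu hg hUf hGf => ?_⟩
  have hs (p r : ℤ × ℤ) (G : Finset (ℤ × ℤ)) :
      ∑ q ∈ G with Below r q, lam p q ^ 2 ≤ C₀ ^ 2 * (dlen p * dlen r) :=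
    sum_below_le_of_tsum_le (mul_nonneg (sq_nonneg _)
      (mul_pos (dlen_pos p) (dlen_pos r)).le) (fun q => sq_nonneg _) (h p r) G
  have hu₀ (p) (hp : p ∉ hUf.toFinset) : u p = 0 := by simpa using hp
  have hg₀ (q) (hq : q ∉ hGf.toFinset) : g q = 0 := by simpa using hq
  have havg (p) : avg 0 p = 0 := by simp [avg]
  rw [tsum_eq_sum (s := hUf.toFinset ×ˢ hGf.toFinset), Finset.sum_product,
    tsum_eq_sum (s := hGf.toFinset) (fun q hq => by simp [hg₀ q hq]),
    tsum_eq_sum (s := hUf.toFinset) (fun p hp => by simp [hu₀ p hp]), Finset.mul_sum]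
  · refine Finset.sum_le_sum fun p _ => ?_
    rcases hC.eq_or_lt with rfl | hC
    · have hz (q) : lam p q = 0 := by
        have := hs p q {q}
        rw [Finset.filter_true_of_mem (by simp [below_iff_of_eq])] at this
        simpa using this
      simp [hz]
    · exact sum_abs_mul_avg_le hC _ (fun r => hs p r _) (hu p) hg
  · rintro ⟨p, q⟩ hpq
    rw [Finset.mem_product, not_and_or] at hpq
    rcases hpq with hp | hq
    · simp [hu₀ p hp, havg]
    · simp [hg₀ q hq, havg]

end
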